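/- Let k ≥ 0 and let y satisfy 2^k ≤ y < 2^{k+1}. If y ∉ {2^{k+1}−1, 2^{k+1}−2}, then every (x,z) ∈ ℕ×ℕ with x+z ≡ −1 (mod 2^{k+1}) belongs to Ulam[y]. If y ∈ {2^{k+1}−1, 2^{k+1}−2}, then every (x,z) ∈ ℕ×ℕ with x+z ≡ −1 (mod 2^{k+1}) and x+z ≠ 2^{k+1}−1 belongs to Ulam[y]. -/

import Mathlib

/-- Fuel-indexed Ulam predicate: a binary word (as a `List Bool`) of length 1 is Ulam,
and a longer word is Ulam iff it is expressible *uniquely* as a concatenation of two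
distinct (nonempty) Ulam words. The fuel strictly exceeds the lengths needed. -/
def ulamAux : ℕ → List Bool → Prop
  | 0, _ => False
  | n + 1, w =>
    if w.length = 1 then True
    else ∃! p : List Bool × List Bool,
      p.1 ≠ [] ∧ p.2 ≠ [] ∧ p.1 ≠ p.2 ∧ w = p.1 ++ p.2 ∧
        ulamAux n p.1 ∧ ulamAux n p.2

/-- A binary word is an Ulam word. -/
def IsUlam (w : List Bool) : Prop := ulamAux w.length w

/-- The word `0^x 1 0^y`. -/
def wordTwo (x y : ℕ) : List Bool :=
  List.replicate x false ++ [true] ++ List.replicate y false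

/-- The word `0^x 1 0^y 1 0^z`. -/
def wordThree (x y z : ℕ) : List Bool :=
  List.replicate x false ++ [true] ++ List.replicate y false ++ [true] ++
    List.replicate z false

/-- `UlamSet y` is the set of pairs `(x,z)` such that `0^x 1 0^y 1 0^z` is Ulam. -/
def UlamSet (y : ℕ) : Set (ℕ × ℕ) := {p | IsUlam (wordThree p.1 y p.2)}

/-- `culam y x z = min(2, N)` where `N` counts `0 ≤ a ≤ y` with both
`w(x,a)` and `w(y-a,z)` Ulam. -/
noncomputable def culam (y x z : ℕ) : ℕ :=
  min 2 {a : ℕ | a ≤ y ∧ IsUlam (wordTwo x a) ∧ IsUlam (wordTwo (y - a) z)}.ncard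

/-- A positive integer is Zumkeller if its binary representation has at most one `0`. -/
def IsZumkeller (y : ℕ) : Prop := 0 < y ∧ (Nat.bits y).count false ≤ 1

/-- The largest `e ≤ d - 1` with `x mod 2^(e+1) < 2^e` and `z mod 2^(e+1) < 2^e`
(and `0` if none exists). -/
def eIdx (d x z : ℕ) : ℕ :=
  Nat.findGreatest (fun e => x % 2 ^ (e + 1) < 2 ^ e ∧ z % 2 ^ (e + 1) < 2 ^ e) (d - 1)

/-- The universal pattern `E1[d]` on `B_d`. -/
def E1 (d x z : ℕ) : ℕ :=
  if 2 ^ d - 1 ≤ x + z then 0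
  else if x % 2 ^ eIdx d x z + z % 2 ^ eIdx d x z < 2 ^ eIdx d x z - 1 then 2 else 1

/-- The universal pattern `E2[d]` on `B_d` (constant `1`). -/
def E2 (_d _x _z : ℕ) : ℕ := 1

/-- The universal pattern `O1[d]` on `B_d`. -/
def O1 (d x z : ℕ) : ℕ :=
  if 2 ^ d - 2 ≤ x + z then 0
  else if (x + z) % 2 = 0 then (if x % 2 = 1 then 0 else 2)
  else if x % 2 ^ eIdx d x z + z % 2 ^ eIdx d x z < 2 ^ eIdx d x z - 1 then 2 else 1

/-- The universal pattern `O2[d]` on `B_d` (independent of `d`). -/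
def O2 (_d x z : ℕ) : ℕ :=
  if (x + z) % 2 = 0 then (if x % 2 = 1 then 0 else 2) else 1

open Finset

/-- The `0`-`1` indicator of a proposition, as a natural number. -/
noncomputable def ind (p : Prop) : ℕ := open Classical in if p then 1 else 0

lemma ind_of_true {p : Prop} (h : p) : ind p = 1 := if_pos h

lemma ind_of_false {p : Prop} (h : ¬p) : ind p = 0 := if_neg h

lemma ind_congr {p q : Prop} (h : p ↔ q) : ind p = ind q := by rw [propext h]

lemma sum_ind_eq_one_iff {ι : Type*} (s : Finset ι) (p : ι → Prop) :
    ∑ i ∈ s, ind (p i) = 1 ↔ ∃! i, i ∈ s ∧ p i := by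
  classical
  have h : ∑ i ∈ s, ind (p i) = #(s.filter p) := by
    rw [card_filter]
    exact sum_congr rfl fun i _ => by unfold ind; congr
  rw [h, card_eq_one, singleton_iff_unique_mem]
  simp

/-! ### Counting decompositions of words -/

lemma ulamAux_congr_fuel (n : ℕ) : ∀ (m : ℕ) (w : List Bool), w.length ≤ n → w.length ≤ m →
    (ulamAux n w ↔ ulamAux m w) := by
  induction n with
  | zero =>
    intro m w hn _
    obtain rfl : w = [] := List.length_eq_zero_iff.mp (by omega)
    cases m <;> simp +contextual [ulamAux, ExistsUnique]
  | succ n ih =>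
    intro m w hn hm
    cases m with
    | zero =>
      obtain rfl : w = [] := List.length_eq_zero_iff.mp (by omega)
      simp +contextual [ulamAux, ExistsUnique]
    | succ m =>
      have key : ∀ p : List Bool × List Bool,
          (p.1 ≠ [] ∧ p.2 ≠ [] ∧ p.1 ≠ p.2 ∧ w = p.1 ++ p.2 ∧
            ulamAux n p.1 ∧ ulamAux n p.2) ↔
          (p.1 ≠ [] ∧ p.2 ≠ [] ∧ p.1 ≠ p.2 ∧ w = p.1 ++ p.2 ∧
            ulamAux m p.1 ∧ ulamAux m p.2) := by
        rintro ⟨u, v⟩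
        refine and_congr_right fun hu => and_congr_right fun hv => and_congr_right fun _ =>
          and_congr_right fun hw => ?_
        have hu := List.length_pos_iff.mpr hu
        have hv := List.length_pos_iff.mpr hv
        have hw := congrArg List.length hw
        simp only [List.length_append] at hw hu hv
        rw [ih m u (by omega) (by omega), ih m v (by omega) (by omega)]
      simp only [ulamAux, key]

lemma isUlam_of_length_eq_one {w : List Bool} (h : w.length = 1) : IsUlam w := by
  simp [IsUlam, h, ulamAux]

lemma isUlam_iff_existsUnique {w : List Bool} (h : w.length ≠ 1) :
    IsUlam w ↔ ∃! p : List Bool × List Bool, p.1 ≠ [] ∧ p.2 ≠ [] ∧ p.1 ≠ p.2 ∧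
      w = p.1 ++ p.2 ∧ IsUlam p.1 ∧ IsUlam p.2 := by
  rw [IsUlam, ulamAux_congr_fuel _ (w.length + 1) w le_rfl (by omega), ulamAux, if_neg h]
  refine existsUnique_congr fun p => ?_
  refine and_congr_right fun _ => and_congr_right fun _ => and_congr_right fun _ =>
    and_congr_right fun hw => ?_
  have hw := congrArg List.length hw
  simp only [List.length_append] at hw
  rw [IsUlam, IsUlam, ulamAux_congr_fuel _ p.1.length p.1 (by omega) le_rfl,
    ulamAux_congr_fuel _ p.2.length p.2 (by omega) le_rfl]

/-- Cutting `w` after its `i`-th letter is an admissible Ulam decomposition. -/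
def SplitsAt (w : List Bool) (i : ℕ) : Prop :=
  w.take i ≠ w.drop i ∧ IsUlam (w.take i) ∧ IsUlam (w.drop i)

lemma isUlam_iff_sum {w : List Bool} (h : w.length ≠ 1) :
    IsUlam w ↔ ∑ i ∈ range (w.length - 1), ind (SplitsAt w (i + 1)) = 1 := by
  rw [isUlam_iff_existsUnique h, sum_ind_eq_one_iff]
  constructor
  · rintro ⟨⟨u, v⟩, ⟨hu, hv, huv, rfl, hu', hv'⟩, huniq⟩
    have hul := List.length_pos_iff.mpr hu
    have hvl := List.length_pos_iff.mpr hv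
    simp only at hul hvl
    refine ⟨u.length - 1, ⟨?_, ?_⟩, ?_⟩
    · simp only [mem_range, List.length_append]; omega
    · simpa [SplitsAt, Nat.sub_add_cancel hul] using ⟨huv, hu', hv'⟩
    · rintro i ⟨hi, hs1, hs2, hs3⟩
      simp only [mem_range, List.length_append] at hi
      have := huniq ((u ++ v).take (i + 1), (u ++ v).drop (i + 1))
        ⟨List.length_pos_iff.mp (by simp; omega), List.length_pos_iff.mp (by simp; omega),
          hs1, (List.take_append_drop _ _).symm, hs2, hs3⟩
      have := congrArg (fun p => p.1.length) this
      simp only [List.length_take, List.length_append] at this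
      omega
  · rintro ⟨i, ⟨hi, hs1, hs2, hs3⟩, huniq⟩
    simp only [mem_range] at hi
    refine ⟨(w.take (i + 1), w.drop (i + 1)),
      ⟨List.length_pos_iff.mp (by simp; omega), List.length_pos_iff.mp (by simp; omega),
        hs1, (List.take_append_drop _ _).symm, hs2, hs3⟩, ?_⟩
    rintro ⟨u, v⟩ ⟨hu, hv, huv, rfl, hu', hv'⟩
    have hul := List.length_pos_iff.mpr hu
    have hvl := List.length_pos_iff.mpr hv
    simp only at hul hvl
    have := huniq (u.length - 1) ⟨by simp only [mem_range, List.length_append]; omega, by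
      simpa [SplitsAt, Nat.sub_add_cancel hul] using ⟨huv, hu', hv'⟩⟩
    simp [show i + 1 = u.length by omega]

lemma isUlam_replicate_false (n : ℕ) : IsUlam (List.replicate n false) ↔ n = 1 := by
  induction n using Nat.strong_induction_on with
  | _ n ih =>
    by_cases h : n = 1
    · simp [h, isUlam_of_length_eq_one]
    · rw [isUlam_iff_sum (by simpa), sum_eq_zero]
      · simp [h]
      · intro i hi
        simp only [List.length_replicate, mem_range] at hi
        refine ind_of_false ?_
        rintro ⟨h1, h2, h3⟩
        simp only [List.take_replicate, List.drop_replicate] at h1 h2 h3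
        rw [ih _ (by omega)] at h2 h3
        exact h1 (by rw [h2, h3])

lemma wordTwo_add_right (x a b : ℕ) :
    wordTwo x (a + b) = wordTwo x a ++ List.replicate b false := by
  simp [wordTwo, List.replicate_add,
      -List.replicate_append_replicate]

@[simp] lemma length_wordTwo (x y : ℕ) : (wordTwo x y).length = x + 1 + y := by
  simp [wordTwo]; omega

@[simp] lemma count_wordTwo (x y : ℕ) : (wordTwo x y).count true = 1 := by
  simp [wordTwo, List.count_append, List.count_replicate]

@[simp] lemma length_wordThree (x y z : ℕ) : (wordThree x y z).length = x + y + z + 2 := by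
  simp [wordThree]; omega

@[simp] lemma count_wordThree (x y z : ℕ) : (wordThree x y z).count true = 2 := by
  simp [wordThree, List.count_append, List.count_replicate]

lemma ne_of_count_ne {u v : List Bool} (h : u.count true ≠ v.count true) : u ≠ v :=
  fun e => h (by rw [e])

/-- A decomposition of a word into two explicit factors. -/
lemma splitsAt_append (u v : List Bool) :
    SplitsAt (u ++ v) u.length ↔ u ≠ v ∧ IsUlam u ∧ IsUlam v := by
  simp [SplitsAt]

lemma splitsAt_wordTwo_left {x i : ℕ} (y : ℕ) (hi : i ≤ x) :
    SplitsAt (wordTwo x y) i ↔ i = 1 ∧ IsUlam (wordTwo (x - i) y) := by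
  have h : wordTwo x y = List.replicate i false ++ wordTwo (x - i) y := by
    obtain ⟨x, rfl⟩ := Nat.exists_eq_add_of_le hi
    simp [wordTwo, List.replicate_add,
      -List.replicate_append_replicate]
  have := splitsAt_append (List.replicate i false) (wordTwo (x - i) y)
  rw [← h, List.length_replicate, isUlam_replicate_false] at this
  rw [this]
  exact and_iff_right (ne_of_count_ne (by simp [List.count_replicate]))

lemma splitsAt_wordTwo_right (x : ℕ) {y i : ℕ} (hi : i ≤ y) :
    SplitsAt (wordTwo x y) (x + 1 + i) ↔ IsUlam (wordTwo x i) ∧ y - i = 1 := by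
  have h : wordTwo x y = wordTwo x i ++ List.replicate (y - i) false := by
    rw [← wordTwo_add_right, Nat.add_sub_cancel' hi]
  have := splitsAt_append (wordTwo x i) (List.replicate (y - i) false)
  rw [← h, length_wordTwo, isUlam_replicate_false] at this
  rw [this]
  exact and_iff_right (ne_of_count_ne (by simp [List.count_replicate]))

lemma splitsAt_wordThree_left {x i : ℕ} (y z : ℕ) (hi : i ≤ x) :
    SplitsAt (wordThree x y z) i ↔ i = 1 ∧ IsUlam (wordThree (x - i) y z) := by
  have h : wordThree x y z = List.replicate i false ++ wordThree (x - i) y z := by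
    obtain ⟨x, rfl⟩ := Nat.exists_eq_add_of_le hi
    simp [wordThree, List.replicate_add,
      -List.replicate_append_replicate]
  have := splitsAt_append (List.replicate i false) (wordThree (x - i) y z)
  rw [← h, List.length_replicate, isUlam_replicate_false] at this
  rw [this]
  exact and_iff_right (ne_of_count_ne (by simp [List.count_replicate]))

lemma splitsAt_wordThree_right (x y : ℕ) {z i : ℕ} (hi : i ≤ z) :
    SplitsAt (wordThree x y z) (x + y + 2 + i) ↔ IsUlam (wordThree x y i) ∧ z - i = 1 := by
  have h : wordThree x y z = wordThree x y i ++ List.replicate (z - i) false := by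
    obtain ⟨z, rfl⟩ := Nat.exists_eq_add_of_le hi
    simp [wordThree, List.replicate_add,
      -List.replicate_append_replicate]
  have := splitsAt_append (wordThree x y i) (List.replicate (z - i) false)
  rw [← h, length_wordThree, isUlam_replicate_false] at this
  rw [show x + y + 2 + i = x + y + i + 2 by omega, this]
  exact and_iff_right (ne_of_count_ne (by simp [List.count_replicate]))

lemma wordTwo_inj {x y x' y' : ℕ} : wordTwo x y = wordTwo x' y' ↔ x = x' ∧ y = y' := by
  refine ⟨fun h => ?_, by rintro ⟨rfl, rfl⟩; rfl⟩
  have hx : x = x' := by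
    have key : ∀ x y, (wordTwo x y).idxOf true = x := by
      intro x y
      simp [wordTwo, List.idxOf_append]
    rw [← key x y, h, key]
  have := congrArg List.length h
  simp only [length_wordTwo] at this
  omega

lemma splitsAt_wordThree_middle (x z : ℕ) {y a : ℕ} (ha : a ≤ y) :
    SplitsAt (wordThree x y z) (x + 1 + a) ↔
      ¬(x = y - a ∧ a = z) ∧ IsUlam (wordTwo x a) ∧ IsUlam (wordTwo (y - a) z) := by
  have h : wordThree x y z = wordTwo x a ++ wordTwo (y - a) z := by
    obtain ⟨y, rfl⟩ := Nat.exists_eq_add_of_le ha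
    simp [wordThree, wordTwo, List.replicate_add,
      -List.replicate_append_replicate]
  have := splitsAt_append (wordTwo x a) (wordTwo (y - a) z)
  rw [← h, length_wordTwo] at this
  rw [this, ne_eq, wordTwo_inj]

/-- The value at `(x - 1, z)`, read as `0` when `x = 0`. -/
def shiftLeft (u : ℕ → ℕ → ℕ) : ℕ → ℕ → ℕ
  | 0, _ => 0
  | x + 1, z => u x z

/-- The value at `(x, z - 1)`, read as `0` when `z = 0`. -/
def shiftRight (u : ℕ → ℕ → ℕ) : ℕ → ℕ → ℕ
  | _, 0 => 0
  | x, z + 1 => u x z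

lemma sum_range_eq_shiftLeft (u : ℕ → ℕ → ℕ) (x z : ℕ) (g : ℕ → ℕ)
    (h0 : ∀ x', x = x' + 1 → g 0 = u x' z) (h : ∀ i, i + 1 < x → g (i + 1) = 0) :
    ∑ i ∈ range x, g i = shiftLeft u x z := by
  cases x with
  | zero => rfl
  | succ x =>
    rw [sum_range_succ', sum_eq_zero fun i hi => h i (by simpa using hi), zero_add, h0 x rfl]
    rfl

lemma sum_range_eq_shiftRight (u : ℕ → ℕ → ℕ) (x z : ℕ) (g : ℕ → ℕ)
    (h0 : ∀ z', z = z' + 1 → g z' = u x z') (h : ∀ i, i + 1 < z → g i = 0) :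
    ∑ i ∈ range z, g i = shiftRight u x z := by
  cases z with
  | zero => rfl
  | succ z =>
    rw [sum_range_succ, sum_eq_zero fun i hi => h i (by simpa using hi), zero_add, h0 z rfl]
    rfl

lemma isUlam_wordTwo_iff_sum {x y : ℕ} (h : 0 < x + y) :
    IsUlam (wordTwo x y) ↔ shiftLeft (fun x z => ind (IsUlam (wordTwo x z))) x y +
      shiftRight (fun x z => ind (IsUlam (wordTwo x z))) x y = 1 := by
  rw [isUlam_iff_sum (by simp; omega), length_wordTwo,
    show x + 1 + y - 1 = x + y by omega, sum_range_add]
  rw [sum_range_eq_shiftLeft (fun x z => ind (IsUlam (wordTwo x z))) x y,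
    sum_range_eq_shiftRight (fun x z => ind (IsUlam (wordTwo x z))) x y]
  · rintro z rfl
    refine ind_congr ?_
    rw [show x + z + 1 = x + 1 + z by omega, splitsAt_wordTwo_right _ (by omega)]
    simp
  · intro i hi
    refine ind_of_false ?_
    rw [show x + i + 1 = x + 1 + i by omega, splitsAt_wordTwo_right _ (by omega)]
    omega
  · rintro x rfl
    refine ind_congr ?_
    rw [splitsAt_wordTwo_left _ (by omega)]
    simp
  · intro i hi
    refine ind_of_false ?_
    rw [splitsAt_wordTwo_left _ (by omega)]
    omega

/-! ### Disjointness of binary expansions -/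

lemma land_even_even (x y : ℕ) : 2 * x &&& 2 * y = 0 ↔ x &&& y = 0 := by
  have := Nat.land_bit false x false y
  simp only [Nat.bit_val, Bool.toNat_false, add_zero, Bool.and_false] at this
  omega

lemma land_even_odd (x y : ℕ) : 2 * x &&& 2 * y + 1 = 0 ↔ x &&& y = 0 := by
  have := Nat.land_bit false x true y
  simp only [Nat.bit_val, Bool.toNat_false, Bool.toNat_true, add_zero, Bool.and_true] at this
  omega

lemma land_odd_even (x y : ℕ) : 2 * x + 1 &&& 2 * y = 0 ↔ x &&& y = 0 := by
  rw [Nat.land_comm, land_even_odd, Nat.land_comm]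

lemma land_odd_odd (x y : ℕ) : ¬(2 * x + 1 &&& 2 * y + 1 = 0) := by
  have := Nat.land_bit true x true y
  simp only [Nat.bit_val, Bool.toNat_true, Bool.and_true] at this
  omega

/-- The indicator of `x` and `y` having disjoint binary expansions. -/
noncomputable def disj (x y : ℕ) : ℕ := ind (x &&& y = 0)

lemma disj_even_even (x y : ℕ) : disj (2 * x) (2 * y) = disj x y :=
  ind_congr (land_even_even x y)

lemma disj_even_odd (x y : ℕ) : disj (2 * x) (2 * y + 1) = disj x y :=
  ind_congr (land_even_odd x y)

lemma disj_odd_even (x y : ℕ) : disj (2 * x + 1) (2 * y) = disj x y :=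
  ind_congr (land_odd_even x y)

lemma disj_odd_odd (x y : ℕ) : disj (2 * x + 1) (2 * y + 1) = 0 :=
  ind_of_false (land_odd_odd x y)

lemma disj_zero_left (y : ℕ) : disj 0 y = 1 := ind_of_true (Nat.zero_and y)

lemma disj_zero_right (x : ℕ) : disj x 0 = 1 := ind_of_true (Nat.and_zero x)

lemma even_or_odd_eq (x : ℕ) : (∃ a, x = 2 * a) ∨ ∃ a, x = 2 * a + 1 :=
  Nat.even_or_odd' x |>.elim fun a h => h.imp (⟨a, ·⟩) (⟨a, ·⟩)

lemma disj_eq_one_iff (n : ℕ) : ∀ x y : ℕ, x + y = n → 0 < n →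
    (disj x y = 1 ↔ shiftLeft disj x y + shiftRight disj x y = 1) := by
  induction n using Nat.strong_induction_on with
  | _ n ih =>
    intro x y hn h0
    rcases even_or_odd_eq x with ⟨x, rfl⟩ | ⟨x, rfl⟩ <;>
      rcases even_or_odd_eq y with ⟨y, rfl⟩ | ⟨y, rfl⟩
    · have hl : shiftLeft disj (2 * x) (2 * y) = shiftLeft disj x y := by
        cases x with
        | zero => rfl
        | succ x => exact disj_odd_even x y
      have hr : shiftRight disj (2 * x) (2 * y) = shiftRight disj x y := by
        cases y with
        | zero => rfl
        | succ y => exact disj_even_odd x y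
      rw [hl, hr, disj_even_even]
      exact ih _ (by omega) x y rfl (by omega)
    · have hl : shiftLeft disj (2 * x) (2 * y + 1) = 0 := by
        cases x with
        | zero => rfl
        | succ x => exact disj_odd_odd x y
      rw [hl, shiftRight, disj_even_odd, disj_even_even, zero_add]
    · have hr : shiftRight disj (2 * x + 1) (2 * y) = 0 := by
        cases y with
        | zero => rfl
        | succ y => exact disj_odd_odd x y
      rw [hr, shiftLeft, disj_odd_even, disj_even_even, add_zero]
    · rw [shiftLeft, shiftRight, disj_odd_odd, disj_even_odd, disj_odd_even]
      omega

lemma isUlam_wordTwo_iff_land (x y : ℕ) : IsUlam (wordTwo x y) ↔ x &&& y = 0 := by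
  induction h : x + y using Nat.strong_induction_on generalizing x y with
  | _ n ih =>
    rcases Nat.eq_zero_or_pos n with rfl | hn
    · obtain ⟨rfl, rfl⟩ : x = 0 ∧ y = 0 := by omega
      simp [isUlam_of_length_eq_one]
    · have hl : shiftLeft (fun x z => ind (IsUlam (wordTwo x z))) x y = shiftLeft disj x y := by
        cases x with
        | zero => rfl
        | succ x => exact ind_congr (ih _ (by omega) x y rfl)
      have hr : shiftRight (fun x z => ind (IsUlam (wordTwo x z))) x y = shiftRight disj x y := by
        cases y with
        | zero => rfl
        | succ y => exact ind_congr (ih _ (by omega) x y rfl)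
      rw [isUlam_wordTwo_iff_sum (by omega), hl, hr, ← disj_eq_one_iff n x y h hn, disj, ind]
      split <;> simp_all

/-- The number of Ulam decompositions of `0^x 1 0^y 1 0^z` that cut between the two ones. -/
noncomputable def middleSplits (y x z : ℕ) : ℕ :=
  ∑ a ∈ range (y + 1), ind (¬(x = y - a ∧ a = z) ∧ x &&& a = 0 ∧ (y - a) &&& z = 0)

lemma isUlam_wordThree_iff_sum (x y z : ℕ) :
    IsUlam (wordThree x y z) ↔ shiftLeft (fun x z => ind (IsUlam (wordThree x y z))) x z +
      shiftRight (fun x z => ind (IsUlam (wordThree x y z))) x z + middleSplits y x z = 1 := by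
  rw [isUlam_iff_sum (by simp), length_wordThree,
    show x + y + z + 2 - 1 = x + (y + 1) + z by omega, sum_range_add, sum_range_add,
    add_right_comm]
  rw [sum_range_eq_shiftLeft (fun x z => ind (IsUlam (wordThree x y z))) x z,
    sum_range_eq_shiftRight (fun x z => ind (IsUlam (wordThree x y z))) x z, middleSplits]
  · rw [sum_congr rfl]
    intro a ha
    rw [mem_range] at ha
    refine ind_congr ?_
    rw [show x + a + 1 = x + 1 + a by omega, splitsAt_wordThree_middle _ _ (by omega),
      isUlam_wordTwo_iff_land, isUlam_wordTwo_iff_land]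
  · rintro z rfl
    refine ind_congr ?_
    rw [show x + (y + 1) + z + 1 = x + y + 2 + z by omega, splitsAt_wordThree_right _ _ (by omega)]
    simp
  · intro i hi
    refine ind_of_false ?_
    rw [show x + (y + 1) + i + 1 = x + y + 2 + i by omega, splitsAt_wordThree_right _ _ (by omega)]
    omega
  · rintro x rfl
    refine ind_congr ?_
    rw [splitsAt_wordThree_left _ _ (by omega)]
    simp
  · intro i hi
    refine ind_of_false ?_
    rw [splitsAt_wordThree_left _ _ (by omega)]
    omega

/-! ### The number of ways to write `y = a + b` with `a`, `b` disjoint from `x`, `z` -/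

/-- The number of `a ≤ y` with `a` disjoint from `x` and `y - a` disjoint from `z`. -/
noncomputable def reps (y x z : ℕ) : ℕ :=
  ∑ a ∈ range (y + 1), disj x a * disj (y - a) z

/-- The indicator of the representation `y = z + x`, the one that gives two equal factors. -/
noncomputable def diagRep (y x z : ℕ) : ℕ := ind (x + z = y ∧ x &&& z = 0)

lemma ind_and (p q : Prop) : ind (p ∧ q) = ind p * ind q := by
  unfold ind
  by_cases p <;> by_cases q <;> simp_all

lemma middleSplits_add_diagRep (y x z : ℕ) :
    middleSplits y x z + diagRep y x z = reps y x z := by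
  have h : diagRep y x z =
      ∑ a ∈ range (y + 1), ind ((x = y - a ∧ a = z) ∧ x &&& a = 0 ∧ (y - a) &&& z = 0) := by
    by_cases hz : z ∈ range (y + 1)
    · rw [sum_eq_single_of_mem z hz fun b _ hb => ind_of_false (by tauto)]
      rw [mem_range] at hz
      refine ind_congr ⟨?_, ?_⟩
      · rintro ⟨h1, h2⟩
        obtain rfl : x = y - z := by omega
        exact ⟨⟨rfl, rfl⟩, h2, h2⟩
      · rintro ⟨⟨h1, -⟩, h2, -⟩
        exact ⟨by omega, h2⟩
    · rw [diagRep, ind_of_false, sum_eq_zero]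
      · intro a ha
        refine ind_of_false ?_
        rintro ⟨⟨-, rfl⟩, -⟩
        exact hz ha
      · rintro ⟨h1, -⟩
        exact hz (mem_range.mpr (by omega))
  rw [h, middleSplits, reps, ← sum_add_distrib]
  refine sum_congr rfl fun a _ => ?_
  rw [disj, disj, ← ind_and]
  unfold ind
  by_cases h1 : x = y - a ∧ a = z <;> simp [h1]

lemma sum_range_two_mul (n : ℕ) (g : ℕ → ℕ) :
    ∑ i ∈ range (2 * n), g i = ∑ i ∈ range n, g (2 * i) + ∑ i ∈ range n, g (2 * i + 1) := by
  induction n with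
  | zero => simp
  | succ n ih =>
    rw [show 2 * (n + 1) = 2 * n + 1 + 1 by ring, sum_range_succ, sum_range_succ, ih,
      sum_range_succ, sum_range_succ]
    ring

lemma reps_odd (y x z : ℕ) : reps (2 * y + 1) x z =
    ∑ a ∈ range (y + 1), disj x (2 * a) * disj (2 * (y - a) + 1) z +
      ∑ a ∈ range (y + 1), disj x (2 * a + 1) * disj (2 * (y - a)) z := by
  rw [reps, show 2 * y + 1 + 1 = 2 * (y + 1) by ring, sum_range_two_mul]
  congr 1 <;> refine sum_congr rfl fun a ha => ?_ <;> rw [mem_range] at ha <;> congr 2 <;> omega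

lemma reps_even (y x z : ℕ) : reps (2 * y) x z =
    ∑ a ∈ range (y + 1), disj x (2 * a) * disj (2 * (y - a)) z +
      ∑ a ∈ range y, disj x (2 * a + 1) * disj (2 * (y - 1 - a) + 1) z := by
  rw [reps, sum_range_succ, sum_range_two_mul, sum_range_succ, add_right_comm]
  congr 1
  · congr 1
    · refine sum_congr rfl fun a ha => ?_
      congr 2; omega
    · congr 2; omega
  · refine sum_congr rfl fun a ha => ?_
    rw [mem_range] at ha
    congr 2; omega

lemma reps_zero (x z : ℕ) : reps 0 x z = 1 := by
  simp [reps, disj_zero_left, disj_zero_right]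

lemma reps_odd_even_even (y x z : ℕ) : reps (2 * y + 1) (2 * x) (2 * z) = 2 * reps y x z := by
  rw [reps_odd, reps, two_mul (∑ _ ∈ _, _)]
  simp only [disj_even_even, disj_even_odd, disj_odd_even]

lemma reps_odd_even_odd (y x z : ℕ) : reps (2 * y + 1) (2 * x) (2 * z + 1) = reps y x z := by
  rw [reps_odd, reps]
  simp [disj_even_even, disj_even_odd, disj_odd_odd]

lemma reps_odd_odd_even (y x z : ℕ) : reps (2 * y + 1) (2 * x + 1) (2 * z) = reps y x z := by
  rw [reps_odd, reps]
  simp [disj_even_even, disj_odd_even, disj_odd_odd]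

lemma reps_odd_odd_odd (y x z : ℕ) : reps (2 * y + 1) (2 * x + 1) (2 * z + 1) = 0 := by
  simp [reps_odd, disj_odd_odd]

lemma reps_even_even_even (y x z : ℕ) :
    reps (2 * (y + 1)) (2 * x) (2 * z) = reps (y + 1) x z + reps y x z := by
  rw [reps_even, reps, reps]
  simp [disj_even_even, disj_even_odd, disj_odd_even]

lemma reps_even_even_odd (y x z : ℕ) : reps (2 * y) (2 * x) (2 * z + 1) = reps y x z := by
  rw [reps_even, reps]
  simp [disj_even_even, disj_even_odd, disj_odd_odd]

lemma reps_even_odd_even (y x z : ℕ) : reps (2 * y) (2 * x + 1) (2 * z) = reps y x z := by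
  rw [reps_even, reps]
  simp [disj_even_even, disj_odd_even, disj_odd_odd]

lemma reps_even_odd_odd (y x z : ℕ) : reps (2 * y) (2 * x + 1) (2 * z + 1) = reps y x z := by
  rw [reps_even, reps]
  simp [disj_even_odd, disj_odd_even, disj_odd_odd]

lemma disj_comm (x y : ℕ) : disj x y = disj y x := by rw [disj, disj, Nat.land_comm]

lemma reps_comm (y x z : ℕ) : reps y x z = reps y z x := by
  rw [reps, ← sum_range_reflect, reps]
  refine sum_congr rfl fun a ha => ?_
  rw [mem_range] at ha
  rw [show y + 1 - 1 - a = y - a by omega, show y - (y - a) = a by omega, mul_comm,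
    disj_comm a, disj_comm x]

lemma reps_zero_left_pos (y z : ℕ) : 0 < reps y 0 z := by
  refine sum_pos' (fun _ _ => Nat.zero_le _) ⟨y, by simp, ?_⟩
  simp [disj_zero_left]

lemma reps_zero_right_pos (y x : ℕ) : 0 < reps y x 0 := by
  rw [reps_comm]; exact reps_zero_left_pos y x

lemma reps_pred_left (y : ℕ) : ∀ x z : ℕ, reps (y + 1) (x + 1) z = 0 →
    reps (y + 1) x z = reps y (x + 1) z := by
  induction y using Nat.strong_induction_on with
  | _ y ih =>
    intro x z h
    rcases even_or_odd_eq y with ⟨y, rfl⟩ | ⟨y, rfl⟩ <;>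
      rcases even_or_odd_eq x with ⟨x, rfl⟩ | ⟨x, rfl⟩ <;>
      rcases even_or_odd_eq z with ⟨z, rfl⟩ | ⟨z, rfl⟩ <;>
      try simp only [show ∀ a, 2 * a + 1 + 1 = 2 * (a + 1) from fun a => by ring] at h ⊢
    · simp only [reps_odd_odd_even, reps_odd_even_even, reps_even_odd_even] at h ⊢
      omega
    · simp only [reps_odd_even_odd, reps_even_odd_odd]
    · rw [reps_odd_even_even] at h
      rcases y with _ | y
      · simp [reps_zero] at h
      · rw [reps_odd_odd_even, reps_even_even_even, ih y (by omega) x z (by omega)]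
        omega
    · simp only [reps_odd_even_odd, reps_odd_odd_odd, reps_even_even_odd] at h ⊢
      omega
    · simp only [reps_even_odd_even, reps_even_even_even, reps_odd_odd_even] at h ⊢
      omega
    · simp only [reps_even_odd_odd, reps_even_even_odd, reps_odd_odd_odd] at h ⊢
      omega
    · rw [reps_even_even_even] at h
      rw [reps_even_odd_even, reps_odd_even_even, ih y (by omega) x z (by omega)]
      omega
    · simp only [reps_even_even_odd, reps_even_odd_odd, reps_odd_even_odd] at h ⊢
      exact ih y (by omega) x z h

lemma reps_pred_left_of_pred_eq_zero (y : ℕ) : ∀ x z : ℕ, reps y (x + 1) z = 0 →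
    reps (y + 1) x z = reps (y + 1) (x + 1) z := by
  induction y using Nat.strong_induction_on with
  | _ y ih =>
    intro x z h
    rcases even_or_odd_eq y with ⟨y, rfl⟩ | ⟨y, rfl⟩ <;>
      rcases even_or_odd_eq x with ⟨x, rfl⟩ | ⟨x, rfl⟩ <;>
      rcases even_or_odd_eq z with ⟨z, rfl⟩ | ⟨z, rfl⟩ <;>
      try simp only [show ∀ a, 2 * a + 1 + 1 = 2 * (a + 1) from fun a => by ring] at h ⊢
    · simp only [reps_odd_odd_even, reps_odd_even_even, reps_even_odd_even] at h ⊢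
      omega
    · simp only [reps_odd_even_odd, reps_even_odd_odd, reps_odd_odd_odd] at h ⊢
      omega
    · rcases y with _ | y
      · simp [reps_zero] at h
      · rw [reps_even_even_even] at h
        rw [reps_odd_odd_even, reps_odd_even_even, ih y (by omega) x z (by omega)]
        omega
    · simp only [reps_odd_even_odd, reps_odd_odd_odd, reps_even_even_odd] at h ⊢
      omega
    · simp only [reps_even_odd_even, reps_even_even_even, reps_odd_odd_even] at h ⊢
      omega
    · simp only [reps_even_odd_odd, reps_even_even_odd]
    · rw [reps_odd_even_even] at h
      rw [reps_even_odd_even, reps_even_even_even, ih y (by omega) x z (by omega)]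
      omega
    · simp only [reps_even_even_odd, reps_even_odd_odd, reps_odd_even_odd] at h ⊢
      exact ih y (by omega) x z h

lemma reps_pred_right {y x z : ℕ} (h : reps (y + 1) x (z + 1) = 0) :
    reps (y + 1) x z = reps y x (z + 1) := by
  rw [reps_comm, reps_comm y]
  exact reps_pred_left y z x (by rwa [reps_comm])

lemma reps_pred_right_of_pred_eq_zero {y x z : ℕ} (h : reps y x (z + 1) = 0) :
    reps (y + 1) x z = reps (y + 1) x (z + 1) := by
  rw [reps_comm, reps_comm (y + 1) x (z + 1)]
  exact reps_pred_left_of_pred_eq_zero y z x (by rwa [reps_comm])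

/-! ### The excluded representation -/

lemma diagRep_le_reps (y x z : ℕ) : diagRep y x z ≤ reps y x z := by
  rw [← middleSplits_add_diagRep]; omega

lemma middleSplits_eq (y x z : ℕ) : middleSplits y x z = reps y x z - diagRep y x z := by
  rw [← middleSplits_add_diagRep]; omega

lemma diagRep_odd_even_odd (y x z : ℕ) :
    diagRep (2 * y + 1) (2 * x) (2 * z + 1) = diagRep y x z :=
  ind_congr (by rw [land_even_odd]; exact and_congr_left fun _ => by omega)

lemma diagRep_odd_odd_even (y x z : ℕ) :
    diagRep (2 * y + 1) (2 * x + 1) (2 * z) = diagRep y x z :=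
  ind_congr (by rw [land_odd_even]; exact and_congr_left fun _ => by omega)

lemma diagRep_even_even_even (y x z : ℕ) :
    diagRep (2 * y) (2 * x) (2 * z) = diagRep y x z :=
  ind_congr (by rw [land_even_even]; exact and_congr_left fun _ => by omega)

lemma diagRep_odd_odd (y x z : ℕ) : diagRep y (2 * x + 1) (2 * z + 1) = 0 :=
  ind_of_false fun h => land_odd_odd x z h.2

lemma diagRep_of_add_ne {y x z : ℕ} (h : x + z ≠ y) : diagRep y x z = 0 :=
  ind_of_false fun h' => h h'.1

/-- If `y` has no representation then moving one unit between `x` and `z` preserves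
whether the excluded representation is present. -/
lemma diagRep_succ_comm (y : ℕ) : ∀ x z : ℕ, reps y (x + 1) (z + 1) = 0 →
    diagRep y x (z + 1) = diagRep y (x + 1) z := by
  induction y using Nat.strong_induction_on with
  | _ y ih =>
    intro x z h
    by_cases hy : x + z + 1 = y
    swap
    · rw [diagRep_of_add_ne (by omega), diagRep_of_add_ne (by omega)]
    rcases even_or_odd_eq x with ⟨x, rfl⟩ | ⟨x, rfl⟩ <;>
      rcases even_or_odd_eq z with ⟨z, rfl⟩ | ⟨z, rfl⟩
    · obtain rfl : y = 2 * (x + z) + 1 := by omega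
      rw [diagRep_odd_even_odd, diagRep_odd_odd_even]
    · obtain rfl : y = 2 * (x + (z + 1)) := by omega
      rw [show 2 * z + 1 + 1 = 2 * (z + 1) by ring] at h ⊢
      rw [reps_even_odd_even] at h
      have := diagRep_le_reps (x + (z + 1)) x (z + 1)
      rw [diagRep_even_even_even, diagRep_odd_odd]
      omega
    · obtain rfl : y = 2 * (x + 1 + z) := by omega
      rw [show 2 * x + 1 + 1 = 2 * (x + 1) by ring] at h ⊢
      rw [reps_even_even_odd] at h
      have := diagRep_le_reps (x + 1 + z) (x + 1) z
      rw [diagRep_even_even_even, diagRep_odd_odd]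
      omega
    · obtain rfl : y = 2 * (x + z + 1) + 1 := by omega
      simp only [show ∀ a, 2 * a + 1 + 1 = 2 * (a + 1) from fun a => by ring] at h ⊢
      rw [reps_odd_even_even] at h
      rw [diagRep_odd_odd_even, diagRep_odd_even_odd]
      exact ih (x + z + 1) (by omega) x z (by omega)

lemma reps_pos_of_add_eq_succ (y : ℕ) : ∀ x z : ℕ, x + z = y + 1 → x &&& z = 0 →
    0 < reps y x z := by
  induction y using Nat.strong_induction_on with
  | _ y ih =>
    intro x z h hd
    rcases even_or_odd_eq x with ⟨x, rfl⟩ | ⟨x, rfl⟩ <;>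
      rcases even_or_odd_eq z with ⟨z, rfl⟩ | ⟨z, rfl⟩
    · obtain ⟨y, rfl⟩ : ∃ w, y = 2 * w + 1 := ⟨x + z - 1, by omega⟩
      rw [reps_odd_even_even]
      have := ih y (by omega) x z (by omega) ((land_even_even x z).1 hd)
      omega
    · obtain rfl : y = 2 * (x + z) := by omega
      have := diagRep_le_reps (x + z) x z
      rw [diagRep, ind_of_true ⟨rfl, (land_even_odd x z).1 hd⟩] at this
      rwa [reps_even_even_odd]
    · obtain rfl : y = 2 * (x + z) := by omega
      have := diagRep_le_reps (x + z) x z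
      rw [diagRep, ind_of_true ⟨rfl, (land_odd_even x z).1 hd⟩] at this
      rwa [reps_even_odd_even]
    · exact absurd hd (land_odd_odd x z)

/-- The excluded representation of `y` is its only one only if all binary digits of `y` are `1`. -/
lemma exists_eq_two_pow_of_reps_eq_one (y : ℕ) : ∀ x z : ℕ, x + z = y → x &&& z = 0 →
    reps y x z = 1 → ∃ j, y + 1 = 2 ^ j := by
  induction y using Nat.strong_induction_on with
  | _ y ih =>
    intro x z h hd h1
    rcases Nat.eq_zero_or_pos y with rfl | hy
    · exact ⟨0, rfl⟩
    have step : ∀ m, y = 2 * m + 1 → x / 2 + z / 2 = m → (x / 2) &&& (z / 2) = 0 →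
        reps m (x / 2) (z / 2) = 1 → ∃ j, y + 1 = 2 ^ j := by
      intro m hm h2 h3 h4
      obtain ⟨j, hj⟩ := ih m (by omega) _ _ h2 h3 h4
      exact ⟨j + 1, by rw [pow_succ]; omega⟩
    rcases even_or_odd_eq x with ⟨x, rfl⟩ | ⟨x, rfl⟩ <;>
      rcases even_or_odd_eq z with ⟨z, rfl⟩ | ⟨z, rfl⟩
    · obtain ⟨m, rfl⟩ : ∃ m, y = 2 * (m + 1) := ⟨x + z - 1, by omega⟩
      rw [land_even_even] at hd
      rw [reps_even_even_even] at h1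
      have h2 := reps_pos_of_add_eq_succ m x z (by omega) hd
      have h3 := diagRep_le_reps (m + 1) x z
      rw [diagRep, ind_of_true ⟨by omega, hd⟩] at h3
      omega
    · have e : (2 * z + 1) / 2 = z := by omega
      refine step (x + z) (by omega) (by omega) ?_ ?_
      · rw [e, Nat.mul_div_cancel_left _ two_pos]
        exact (land_even_odd x z).1 hd
      · obtain rfl : y = 2 * (x + z) + 1 := by omega
        rw [e, Nat.mul_div_cancel_left _ two_pos]
        rwa [reps_odd_even_odd] at h1
    · have e : (2 * x + 1) / 2 = x := by omega
      refine step (x + z) (by omega) (by omega) ?_ ?_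
      · rw [e, Nat.mul_div_cancel_left _ two_pos]
        exact (land_odd_even x z).1 hd
      · obtain rfl : y = 2 * (x + z) + 1 := by omega
        rw [e, Nat.mul_div_cancel_left _ two_pos]
        rwa [reps_odd_odd_even] at h1
    · exact absurd hd (land_odd_odd x z)

lemma reps_full_diagonal (d : ℕ) : ∀ y x z : ℕ, y < 2 ^ d → (x + z) % 2 ^ d = 2 ^ d - 1 →
    reps y x z = 1 := by
  induction d with
  | zero =>
    intro y x z hy _
    obtain rfl : y = 0 := by simpa using hy
    exact reps_zero x z
  | succ d ih =>
    intro y x z hy h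
    have hp : 0 < 2 ^ d := by positivity
    rw [pow_succ] at hy h
    have key : ∀ q r, r < 2 → (2 * q + r) % (2 ^ d * 2) = 2 ^ d * 2 - 1 →
        r = 1 ∧ q % 2 ^ d = 2 ^ d - 1 := by
      intro q r hr h
      rw [mul_comm (2 ^ d), Nat.mod_mul, show (2 * q + r) / 2 = q by omega] at h
      omega
    rcases even_or_odd_eq x with ⟨x, rfl⟩ | ⟨x, rfl⟩ <;>
      rcases even_or_odd_eq z with ⟨z, rfl⟩ | ⟨z, rfl⟩
    · have := key (x + z) 0 (by omega) (by rw [← h]; congr 1; ring)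
      omega
    · have := (key (x + z) 1 (by omega) (by rw [← h]; congr 1; ring)).2
      rcases even_or_odd_eq y with ⟨y, rfl⟩ | ⟨y, rfl⟩
      · rw [reps_even_even_odd]; exact ih y x z (by omega) this
      · rw [reps_odd_even_odd]; exact ih y x z (by omega) this
    · have := (key (x + z) 1 (by omega) (by rw [← h]; congr 1; ring)).2
      rcases even_or_odd_eq y with ⟨y, rfl⟩ | ⟨y, rfl⟩
      · rw [reps_even_odd_even]; exact ih y x z (by omega) this
      · rw [reps_odd_odd_even]; exact ih y x z (by omega) this
    · have := key (x + z + 1) 0 (by omega) (by rw [← h]; congr 1; ring)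
      omega

/-! ### The recursion along diagonals -/

/-- The indicator of `g x z = 1`. -/
def isOne (g : ℕ → ℕ → ℕ) (x z : ℕ) : ℕ := if g x z = 1 then 1 else 0

lemma isOne_of_eq {g : ℕ → ℕ → ℕ} {x z : ℕ} (h : g x z = 1) : isOne g x z = 1 := if_pos h

lemma isOne_of_ne {g : ℕ → ℕ → ℕ} {x z : ℕ} (h : g x z ≠ 1) : isOne g x z = 0 := if_neg h

/-- `u` is the indicator of exactly one decomposition, where `G` counts those in the middle. -/
def SatisfiesRec (G u : ℕ → ℕ → ℕ) : Prop :=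
  ∀ x z, u x z = if shiftLeft u x z + shiftRight u x z + G x z = 1 then 1 else 0

/-- On the diagonal of sum `2n - 1` the values of `u` are given by `isOne g`. -/
def OddDiagonal (u g : ℕ → ℕ → ℕ) (n : ℕ) : Prop :=
  ∀ x z, x + z + 1 = n → u (2 * x) (2 * z + 1) = isOne g x z ∧ u (2 * x + 1) (2 * z) = isOne g x z

section Recursion

variable {G u g : ℕ → ℕ → ℕ} {n : ℕ}

lemma SatisfiesRec.even_even (hu : SatisfiesRec G u) (h : OddDiagonal u g n) {x z : ℕ}
    (hn : x + z = n) : u (2 * x) (2 * z) =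
      if shiftLeft (isOne g) x z + shiftRight (isOne g) x z + G (2 * x) (2 * z) = 1
      then 1 else 0 := by
  have hl : shiftLeft u (2 * x) (2 * z) = shiftLeft (isOne g) x z := by
    cases x with
    | zero => rfl
    | succ x => exact (h x z (by omega)).2
  have hr : shiftRight u (2 * x) (2 * z) = shiftRight (isOne g) x z := by
    cases z with
    | zero => rfl
    | succ z => exact (h x z (by omega)).1
  rw [hu, hl, hr]

lemma SatisfiesRec.odd_odd (hu : SatisfiesRec G u) (h : OddDiagonal u g n) {x z : ℕ}
    (hn : x + z + 1 = n) : u (2 * x + 1) (2 * z + 1) =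
      if 2 * isOne g x z + G (2 * x + 1) (2 * z + 1) = 1 then 1 else 0 := by
  rw [hu, shiftLeft, shiftRight, (h x z hn).1, (h x z hn).2, two_mul (isOne g x z)]

lemma SatisfiesRec.even_odd (hu : SatisfiesRec G u) (x z : ℕ) : u (2 * x) (2 * z + 1) =
    if shiftLeft (fun x z => u (2 * x + 1) (2 * z + 1)) x z + u (2 * x) (2 * z) +
      G (2 * x) (2 * z + 1) = 1 then 1 else 0 := by
  rw [hu]
  cases x <;> rfl

lemma SatisfiesRec.odd_even (hu : SatisfiesRec G u) (x z : ℕ) : u (2 * x + 1) (2 * z) =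
    if u (2 * x) (2 * z) + shiftRight (fun x z => u (2 * x + 1) (2 * z + 1)) x z +
      G (2 * x + 1) (2 * z) = 1 then 1 else 0 := by
  rw [hu]
  cases z <;> rfl

lemma shiftLeft_eq_zero {f : ℕ → ℕ → ℕ} (h : ∀ x z, x + z + 1 = n → f x z = 0) {x z : ℕ}
    (hn : x + z = n) : shiftLeft f x z = 0 := by
  cases x with
  | zero => rfl
  | succ x => exact h x z (by omega)

lemma shiftRight_eq_zero {f : ℕ → ℕ → ℕ} (h : ∀ x z, x + z + 1 = n → f x z = 0) {x z : ℕ}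
    (hn : x + z = n) : shiftRight f x z = 0 := by
  cases z with
  | zero => rfl
  | succ z => exact h x z (by omega)

lemma SatisfiesRec.oddDiagonal_succ (hu : SatisfiesRec G u)
    (hl : ∀ x z, G (2 * x) (2 * z + 1) = g x z) (hr : ∀ x z, G (2 * x + 1) (2 * z) = g x z)
    (h : OddDiagonal u g n)
    (hee : ∀ x z, x + z = n →
      shiftLeft (isOne g) x z + shiftRight (isOne g) x z + G (2 * x) (2 * z) ≠ 1)
    (hoo : ∀ x z, x + z + 1 = n → 2 * isOne g x z + G (2 * x + 1) (2 * z + 1) ≠ 1) :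
    OddDiagonal u g (n + 1) := by
  have h1 : ∀ x z, x + z + 1 = n → u (2 * x + 1) (2 * z + 1) = 0 := fun x z hn => by
    rw [hu.odd_odd h hn, if_neg (hoo x z hn)]
  intro x z hn
  have hn : x + z = n := by omega
  have h0 : u (2 * x) (2 * z) = 0 := by rw [hu.even_even h hn, if_neg (hee x z hn)]
  rw [hu.even_odd, hu.odd_even, h0, shiftLeft_eq_zero h1 hn, shiftRight_eq_zero h1 hn, hl, hr]
  simp [isOne]

end Recursion

/-! ### The middle decompositions on each parity class -/

lemma middleSplits_odd_even_odd (k x z : ℕ) :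
    middleSplits (2 * k + 1) (2 * x) (2 * z + 1) = middleSplits k x z := by
  rw [middleSplits_eq, middleSplits_eq, reps_odd_even_odd, diagRep_odd_even_odd]

lemma middleSplits_odd_odd_even (k x z : ℕ) :
    middleSplits (2 * k + 1) (2 * x + 1) (2 * z) = middleSplits k x z := by
  rw [middleSplits_eq, middleSplits_eq, reps_odd_odd_even, diagRep_odd_odd_even]

lemma middleSplits_odd_odd_odd (k x z : ℕ) :
    middleSplits (2 * k + 1) (2 * x + 1) (2 * z + 1) = 0 := by
  rw [middleSplits_eq, reps_odd_odd_odd, Nat.zero_sub]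

lemma middleSplits_odd_even_even (k x z : ℕ) :
    middleSplits (2 * k + 1) (2 * x) (2 * z) = 2 * reps k x z := by
  rw [middleSplits_eq, reps_odd_even_even, diagRep_of_add_ne (by omega), Nat.sub_zero]

lemma middleSplits_even_even_odd (k x z : ℕ) :
    middleSplits (2 * k) (2 * x) (2 * z + 1) = reps k x z := by
  rw [middleSplits_eq, reps_even_even_odd, diagRep_of_add_ne (by omega), Nat.sub_zero]

lemma middleSplits_even_odd_even (k x z : ℕ) :
    middleSplits (2 * k) (2 * x + 1) (2 * z) = reps k x z := by
  rw [middleSplits_eq, reps_even_odd_even, diagRep_of_add_ne (by omega), Nat.sub_zero]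

lemma middleSplits_even_odd_odd (k x z : ℕ) :
    middleSplits (2 * k) (2 * x + 1) (2 * z + 1) = reps k x z := by
  rw [middleSplits_eq, reps_even_odd_odd, diagRep_odd_odd, Nat.sub_zero]

lemma middleSplits_even_even_even (k x z : ℕ) :
    middleSplits (2 * (k + 1)) (2 * x) (2 * z) =
      reps (k + 1) x z + reps k x z - diagRep (k + 1) x z := by
  rw [middleSplits_eq, reps_even_even_even, diagRep_even_even_even]

/-! ### Structure of the odd diagonals -/

lemma two_mul_isOne_add_ne_one (g : ℕ → ℕ → ℕ) (x z : ℕ) : 2 * isOne g x z + g x z ≠ 1 := by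
  unfold isOne
  split <;> omega

lemma reps_ne_zero_of_eq_zero {k x z : ℕ} (h : x = 0 ∨ z = 0) : reps k x z ≠ 0 := by
  rcases h with rfl | rfl
  · exact (reps_zero_left_pos k z).ne'
  · exact (reps_zero_right_pos k x).ne'

lemma oddDiagonal_of_odd {k : ℕ} {u : ℕ → ℕ → ℕ} (hu : SatisfiesRec (middleSplits (2 * k + 1)) u)
    (n : ℕ) : OddDiagonal u (middleSplits k) n := by
  induction n with
  | zero => intro x z h; omega
  | succ n ih =>
    refine hu.oddDiagonal_succ (middleSplits_odd_even_odd k) (middleSplits_odd_odd_even k) ih ?_ ?_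
    · intro x z _
      rw [middleSplits_odd_even_even]
      by_cases h0 : reps k x z = 0
      · rcases x with _ | x
        · exact absurd h0 (reps_ne_zero_of_eq_zero (.inl rfl))
        rcases z with _ | z
        · exact absurd h0 (reps_ne_zero_of_eq_zero (.inr rfl))
        rcases k with _ | k
        · simp [reps_zero] at h0
        have h1 : middleSplits (k + 1) x (z + 1) = middleSplits (k + 1) (x + 1) z := by
          rw [middleSplits_eq, middleSplits_eq, diagRep_succ_comm _ _ _ h0,
            reps_pred_left _ _ _ h0, reps_pred_right h0]
        rw [shiftLeft, shiftRight, isOne, isOne, h1, h0]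
        omega
      · omega
    · intro x z _
      rw [middleSplits_odd_odd_odd]
      omega

/-- The even diagonals vanish for an even middle gap `2 (k + 1)`, ignoring the excluded
representation. -/
lemma shift_add_reps_ne_one (k x z : ℕ) :
    shiftLeft (isOne (reps (k + 1))) x z + shiftRight (isOne (reps (k + 1))) x z +
      (reps (k + 1) x z + reps k x z) ≠ 1 := by
  by_cases h : reps (k + 1) x z = 0 ∨ reps k x z = 0
  · rcases x with _ | x
    · exact absurd h (not_or.2 ⟨reps_ne_zero_of_eq_zero (.inl rfl),
        reps_ne_zero_of_eq_zero (.inl rfl)⟩)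
    rcases z with _ | z
    · exact absurd h (not_or.2 ⟨reps_ne_zero_of_eq_zero (.inr rfl),
        reps_ne_zero_of_eq_zero (.inr rfl)⟩)
    rw [shiftLeft, shiftRight, isOne, isOne]
    rcases h with h | h
    · rw [reps_pred_left _ _ _ h, reps_pred_right h, h]
      split <;> omega
    · rw [reps_pred_left_of_pred_eq_zero _ _ _ h, reps_pred_right_of_pred_eq_zero h, h]
      split <;> omega
  · omega

lemma shift_add_middleSplits_ne_one {k x z : ℕ} (h : (∀ j, k + 2 ≠ 2 ^ j) ∨ x + z ≠ k + 1) :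
    shiftLeft (isOne (reps (k + 1))) x z + shiftRight (isOne (reps (k + 1))) x z +
      middleSplits (2 * (k + 1)) (2 * x) (2 * z) ≠ 1 := by
  rw [middleSplits_even_even_even]
  by_cases hd : x + z = k + 1 ∧ x &&& z = 0
  · have h1 := diagRep_le_reps (k + 1) x z
    rw [diagRep, ind_of_true hd] at h1 ⊢
    have h2 := reps_pos_of_add_eq_succ k x z hd.1 hd.2
    have h3 : reps (k + 1) x z ≠ 1 := fun h3 => by
      obtain ⟨j, hj⟩ := exists_eq_two_pow_of_reps_eq_one _ x z hd.1 hd.2 h3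
      rcases h with h | h
      · exact h j hj
      · exact h hd.1
    omega
  · rw [diagRep, ind_of_false hd, Nat.sub_zero]
    exact shift_add_reps_ne_one k x z

lemma oddDiagonal_succ_of_even {k n : ℕ} {u : ℕ → ℕ → ℕ}
    (hu : SatisfiesRec (middleSplits (2 * (k + 1))) u) (h : (∀ j, k + 2 ≠ 2 ^ j) ∨ n ≠ k + 1)
    (hn : OddDiagonal u (reps (k + 1)) n) : OddDiagonal u (reps (k + 1)) (n + 1) := by
  refine hu.oddDiagonal_succ (middleSplits_even_even_odd _) (middleSplits_even_odd_even _) hn ?_ ?_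
  · rintro x z rfl
    exact shift_add_middleSplits_ne_one h
  · intro x z _
    rw [middleSplits_even_odd_odd]
    exact two_mul_isOne_add_ne_one _ _ _

lemma oddDiagonal_of_even {k n : ℕ} {u : ℕ → ℕ → ℕ}
    (hu : SatisfiesRec (middleSplits (2 * (k + 1))) u) (h : (∀ j, k + 2 ≠ 2 ^ j) ∨ n ≤ k + 1) :
    OddDiagonal u (reps (k + 1)) n := by
  induction n with
  | zero => intro x z h; omega
  | succ n ih =>
    exact oddDiagonal_succ_of_even hu (h.imp_right fun h => by omega)
      (ih (h.imp_right fun h => by omega))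

/-- For odd `k`, the parity of `reps k` on even diagonals. -/
lemma reps_odd_ne_one {k x z : ℕ} (h : (x + z) % 2 = 0) : reps (2 * k + 1) x z ≠ 1 := by
  rcases even_or_odd_eq x with ⟨x, rfl⟩ | ⟨x, rfl⟩ <;>
    rcases even_or_odd_eq z with ⟨z, rfl⟩ | ⟨z, rfl⟩
  · rw [reps_odd_even_even]; omega
  · omega
  · omega
  · rw [reps_odd_odd_odd]; omega

lemma land_eq_zero_of_add_succ_eq_two_pow (j : ℕ) : ∀ x z : ℕ, x + z + 1 = 2 ^ j → x &&& z = 0 := by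
  induction j with
  | zero =>
    intro x z h
    obtain rfl : x = 0 := by rw [pow_zero] at h; omega
    exact Nat.zero_and z
  | succ j ih =>
    intro x z h
    rw [pow_succ] at h
    rcases even_or_odd_eq x with ⟨x, rfl⟩ | ⟨x, rfl⟩ <;>
      rcases even_or_odd_eq z with ⟨z, rfl⟩ | ⟨z, rfl⟩
    · omega
    · exact (land_even_odd x z).2 (ih x z (by omega))
    · exact (land_odd_even x z).2 (ih x z (by omega))
    · omega

/-- When `y = 2 (k + 1)` with `k + 2` a power of two, the recursion is back on track after the
exceptional diagonals `y, …, y + 2`. -/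
lemma oddDiagonal_of_exceptional {k j : ℕ} {u : ℕ → ℕ → ℕ}
    (hu : SatisfiesRec (middleSplits (2 * (k + 1))) u) (hk : k + 2 = 2 ^ j) :
    OddDiagonal u (reps (k + 1)) (k + 3) := by
  have hodd : ∃ m, k = 2 * m := by
    rcases j with _ | j
    · omega
    · exact ⟨2 ^ j - 1, by rw [pow_succ] at hk; omega⟩
  obtain ⟨m, hm⟩ := hodd
  have hne : ∀ {x z}, (x + z) % 2 = 0 → reps (k + 1) x z ≠ 1 := fun h => by
    rw [hm]; exact reps_odd_ne_one h
  have hfull : ∀ {l x z}, l < k + 2 → x + z = k + 1 → reps l x z = 1 := fun hl h =>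
    reps_full_diagonal j _ _ _ (by omega) (by rw [h, ← hk, Nat.mod_eq_of_lt] <;> omega)
  have hprev : OddDiagonal u (reps (k + 1)) (k + 1) := oddDiagonal_of_even hu (.inr le_rfl)
  have hzero : ∀ x z, x + z + 1 = k + 1 → isOne (reps (k + 1)) x z = 0 := fun x z h =>
    isOne_of_ne (hne (by omega))
  have hoo : ∀ x z, x + z + 1 = k + 1 → u (2 * x + 1) (2 * z + 1) = 0 := fun x z h => by
    rw [hu.odd_odd hprev h, middleSplits_even_odd_odd, if_neg (two_mul_isOne_add_ne_one _ _ _)]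
  have hee : ∀ x z, x + z = k + 1 → u (2 * x) (2 * z) = 1 := fun x z h => by
    have hd : x &&& z = 0 := land_eq_zero_of_add_succ_eq_two_pow j x z (by omega)
    rw [hu.even_even hprev h, shiftLeft_eq_zero hzero h, shiftRight_eq_zero hzero h,
      middleSplits_even_even_even, hfull (by omega) h, hfull (by omega) h, diagRep,
      ind_of_true ⟨h, hd⟩, if_pos rfl]
  have hfst : ∀ x z, x + z = k + 1 → u (2 * x) (2 * z + 1) = 0 ∧ u (2 * x + 1) (2 * z) = 0 := by
    intro x z h
    rw [hu.even_odd, hu.odd_even, shiftLeft_eq_zero hoo h, shiftRight_eq_zero hoo h, hee x z h,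
      middleSplits_even_even_odd, middleSplits_even_odd_even, hfull (by omega) h]
    simp
  have hdiag : OddDiagonal u (fun _ _ => 0) (k + 2) := fun x z h => hfst x z (by omega)
  have hone : ∀ x z, x + z = k + 1 → u (2 * x + 1) (2 * z + 1) = 1 := fun x z h => by
    rw [hu.odd_odd hdiag (by omega), middleSplits_even_odd_odd, hfull (by omega) h]
    rfl
  have hone' : ∀ x z, x + z = k + 2 → reps (k + 1) x z = 0 → u (2 * x) (2 * z) = 1 := by
    intro x z h h0
    rcases x with _ | x
    · exact absurd h0 (reps_ne_zero_of_eq_zero (.inl rfl))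
    have hz : ∀ x z, x + z + 1 = k + 2 → isOne (fun _ _ => 0) x z = 0 := fun _ _ _ => rfl
    rw [hu.even_even hdiag h, shiftLeft_eq_zero hz h, shiftRight_eq_zero hz h, middleSplits_even_even_even,
      h0, ← reps_pred_left _ _ _ h0, hfull (by omega) (by omega), diagRep_of_add_ne (by omega)]
    rfl
  intro x z h
  have hxz : x + z = k + 2 := by omega
  have h1 : reps (k + 1) x z ≠ 1 := hne (by omega)
  rw [hu.even_odd, hu.odd_even, middleSplits_even_even_odd, middleSplits_even_odd_even,
    isOne_of_ne h1]
  by_cases h0 : reps (k + 1) x z = 0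
  · have h2 := hone' x z hxz h0
    rcases x with _ | x
    · exact absurd h0 (reps_ne_zero_of_eq_zero (.inl rfl))
    rcases z with _ | z
    · exact absurd h0 (reps_ne_zero_of_eq_zero (.inr rfl))
    rw [shiftLeft, shiftRight, hone _ _ (by omega), hone _ _ (by omega), h2, h0]
    simp
  · rw [if_neg (by omega), if_neg (by omega)]
    exact ⟨rfl, rfl⟩

lemma oddDiagonal_of_exceptional_of_le {k j n : ℕ} {u : ℕ → ℕ → ℕ}
    (hu : SatisfiesRec (middleSplits (2 * (k + 1))) u) (hk : k + 2 = 2 ^ j) (hn : k + 3 ≤ n) :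
    OddDiagonal u (reps (k + 1)) n := by
  induction n, hn using Nat.le_induction with
  | base => exact oddDiagonal_of_exceptional hu hk
  | succ n hn ih => exact oddDiagonal_succ_of_even hu (.inr (by omega)) ih

/-- The indicator of `Ulam[y]`. -/
noncomputable def ulamInd (y x z : ℕ) : ℕ := ind (IsUlam (wordThree x y z))

lemma satisfiesRec_ulamInd (y : ℕ) : SatisfiesRec (middleSplits y) (ulamInd y) := by
  intro x z
  rw [ulamInd, ind_congr (isUlam_wordThree_iff_sum x y z)]
  rw [ind]
  congr

lemma mem_ulamSet_iff (y x z : ℕ) : (x, z) ∈ UlamSet y ↔ ulamInd y x z = 1 := by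
  simp [UlamSet, ulamInd, ind]

lemma ulamInd_eq_one_of_oddDiagonal {y s x z : ℕ} {g : ℕ → ℕ → ℕ} (hs : x + z = 2 * s + 1)
    (h : OddDiagonal (ulamInd y) g (s + 1)) (hg : ∀ a b, a + b = s → g a b = 1) :
    ulamInd y x z = 1 := by
  rcases even_or_odd_eq x with ⟨x, rfl⟩ | ⟨x, rfl⟩ <;>
    rcases even_or_odd_eq z with ⟨z, rfl⟩ | ⟨z, rfl⟩
  · omega
  · rw [(h x z (by omega)).1, isOne_of_eq (hg x z (by omega))]
  · rw [(h x z (by omega)).2, isOne_of_eq (hg x z (by omega))]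
  · omega

/-- A common form of the regular and exceptional cases. -/
lemma mem_ulamSet_of_full_diagonal {k y x z : ℕ} (h1 : 2 ^ k ≤ y) (h2 : y < 2 ^ (k + 1))
    (h : (x + z) % 2 ^ (k + 1) = 2 ^ (k + 1) - 1)
    (hexc : (y ≠ 2 ^ (k + 1) - 1 ∧ y ≠ 2 ^ (k + 1) - 2) ∨ x + z ≠ 2 ^ (k + 1) - 1) :
    (x, z) ∈ UlamSet y := by
  rw [mem_ulamSet_iff]
  have hp : 0 < 2 ^ k := by positivity
  rw [pow_succ] at h h2 hexc
  have hmod := Nat.mod_add_div (x + z) (2 ^ k * 2)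
  rw [h] at hmod
  obtain ⟨q, hq⟩ : ∃ q, (x + z) / (2 ^ k * 2) = q := ⟨_, rfl⟩
  rw [hq] at hmod
  have hmul : 2 ^ k * 2 * q = 2 * (2 ^ k * q) := by ring
  obtain ⟨s, hs, hsq⟩ : ∃ s, x + z = 2 * s + 1 ∧ s = 2 ^ k - 1 + 2 ^ k * q :=
    ⟨2 ^ k - 1 + 2 ^ k * q, by omega, rfl⟩
  have hsm : s % 2 ^ k = 2 ^ k - 1 := by
    rw [hsq, Nat.add_mul_mod_self_left, Nat.mod_eq_of_lt (by omega)]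
  have hu := satisfiesRec_ulamInd y
  have hr : ∀ m, m < 2 ^ k → ∀ a b, a + b = s → reps m a b = 1 := fun m hm a b hab =>
    reps_full_diagonal k m a b hm (by rw [hab, hsm])
  rcases even_or_odd_eq y with ⟨m, rfl⟩ | ⟨m, rfl⟩
  · obtain ⟨m, rfl⟩ := Nat.exists_eq_succ_of_ne_zero (show m ≠ 0 by omega)
    refine ulamInd_eq_one_of_oddDiagonal hs ?_ (hr (m + 1) (by omega))
    by_cases hm : ∃ j, m + 2 = 2 ^ j
    · obtain ⟨j, hj⟩ := hm
      have hjk : j = k := by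
        have hjle : j < k + 1 := (Nat.pow_lt_pow_iff_right one_lt_two).1 (by rw [pow_succ]; omega)
        have hkle : k < j + 1 := (Nat.pow_lt_pow_iff_right one_lt_two).1 (by rw [pow_succ]; omega)
        omega
      subst hjk
      rcases q with _ | q
      · omega
      · refine oddDiagonal_of_exceptional_of_le hu hj ?_
        rw [mul_add_one] at hsq
        omega
    · exact oddDiagonal_of_even hu (.inl fun j hj => hm ⟨j, hj⟩)
  · refine ulamInd_eq_one_of_oddDiagonal hs (oddDiagonal_of_odd hu _) fun a b hab => ?_
    rw [middleSplits_eq, hr m (by omega) a b hab, diagRep_of_add_ne]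
    omega

/-- the full diagonal `x + z ≡ -1 (mod 2^(k+1))` lies in `Ulam[y]`,
except for the diagonal `x + z = 2^(k+1) - 1` when `y ∈ {2^(k+1)-1, 2^(k+1)-2}`. -/
theorem ulamSet_full_diagonal (k y : ℕ) (h1 : 2 ^ k ≤ y) (h2 : y < 2 ^ (k + 1)) :
    (y ≠ 2 ^ (k + 1) - 1 → y ≠ 2 ^ (k + 1) - 2 →
      ∀ x z : ℕ, (x + z) % 2 ^ (k + 1) = 2 ^ (k + 1) - 1 → (x, z) ∈ UlamSet y) ∧
    ((y = 2 ^ (k + 1) - 1 ∨ y = 2 ^ (k + 1) - 2) →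
      ∀ x z : ℕ, (x + z) % 2 ^ (k + 1) = 2 ^ (k + 1) - 1 →
        x + z ≠ 2 ^ (k + 1) - 1 → (x, z) ∈ UlamSet y) := by
  exact ⟨fun hy hy' x z h => mem_ulamSet_of_full_diagonal h1 h2 h (.inl ⟨hy, hy'⟩),
    fun _ x z h hxz => mem_ulamSet_of_full_diagonal h1 h2 h (.inr hxz)⟩
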